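/- Let n and h be positive integers and m a non-negative integer with h ≤ n − m. Then, as an identity in the field of rational functions Q(q, c, x): ∑_{j=0}^{m} ∑_{k=0}^{n} (q^{-n};q)_j (q^{-n};q)_k (x;q)_j (x;q)_k (q^{j-m-h+1};q)_{h-1} (q^{k-m-h+1};q)_{h-1} (1-q^{k-j}) q^{2j+k} / ((q;q)_j (q;q)_k (c;q)_j (c;q)_k) = (-1)^{m-1} (q;q)_n (q;q)_{h-1} (x;q)_{m+h} (c/x;q)_{n-h} x^{n-h} q^{(m^2+3m)/2 - mn - mh - h^2 + h} / ((q;q)_m (c;q)_m (c;q)_n (q;q)_{n-m-h}). -/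

import Mathlib

open Finset

/-- The q-Pochhammer symbol `(a;q)_n = ∏_{j=0}^{n-1} (1 - a q^j)`. -/
noncomputable def qPoch {F : Type*} [Field F] (q a : F) (n : ℕ) : F :=
  ∏ j ∈ Finset.range n, (1 - a * q ^ j)

/-- The field of rational functions `ℚ(q, c, x)`. -/
abbrev F3 : Type := FractionRing (MvPolynomial (Fin 3) ℚ)

noncomputable def q : F3 := algebraMap (MvPolynomial (Fin 3) ℚ) F3 (MvPolynomial.X 0)
noncomputable def c : F3 := algebraMap (MvPolynomial (Fin 3) ℚ) F3 (MvPolynomial.X 1)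
noncomputable def x : F3 := algebraMap (MvPolynomial (Fin 3) ℚ) F3 (MvPolynomial.X 2)


section aux
variable {F : Type*} [Field F]

lemma qP_succ (q a : F) (n : ℕ) : qPoch q a (n+1) = qPoch q a n * (1 - a * q^n) := by
  simp [qPoch, Finset.prod_range_succ]

lemma qP_zero (q a : F) : qPoch q a 0 = 1 := by simp [qPoch]

lemma qP_add (q a : F) (n k : ℕ) : qPoch q a (n+k) = qPoch q a n * qPoch q (a * q^n) k := by
  simp only [qPoch, Finset.prod_range_add]
  congr 1
  apply Finset.prod_congr rfl
  intro i _
  ring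

lemma qP_succ' (q a : F) (n : ℕ) : qPoch q a (n+1) = (1 - a) * qPoch q (a * q) n := by
  rw [add_comm, qP_add]; simp [qPoch]

lemma qP_shift (q a : F) (n : ℕ) :
    (1 - a) * qPoch q (a * q) n = qPoch q a n * (1 - a * q^n) := by
  rw [← qP_succ', qP_succ]

lemma qP_ne (q a : F) (n : ℕ) (h : ∀ i, 1 - a * q^i ≠ 0) : qPoch q a n ≠ 0 := by
  simp only [qPoch]
  exact Finset.prod_ne_zero_iff.2 fun i _ => h i

lemma qP_inv_zero (q : F) (hq0 : q ≠ 0) (n k : ℕ) (h : n < k) : qPoch q ((q^n)⁻¹) k = 0 := by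
  simp only [qPoch]
  apply Finset.prod_eq_zero (Finset.mem_range.2 h)
  rw [inv_mul_cancel₀ (pow_ne_zero _ hq0), sub_self]

lemma inv_shift (q : F) (hq0 : q ≠ 0) (n : ℕ) : (q^(n+1))⁻¹ * q = (q^n)⁻¹ := by
  field_simp
  ring
lemma qP_rev (q : F) (hq0 : q ≠ 0) (n t : ℕ) (ht : n * (n+1) = 2 * t) :
    qPoch q ((q^n)⁻¹) n * q^t = (-1)^n * qPoch q q n := by
  induction n generalizing t with
  | zero => simp at ht; subst ht; simp [qPoch]
  | succ n ih =>
    obtain ⟨s, hs⟩ := Nat.even_mul_succ_self n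
    have hts : t = s + (n+1) := by nlinarith
    have h1 := ih s (by omega)
    rw [qP_succ', inv_shift q hq0, qP_succ, hts, pow_add, pow_succ (-1 : F)]
    have : (1 - (q^(n+1))⁻¹) * q^(n+1) = -(1 - q * q^n) := by
      field_simp; ring
    linear_combination (qPoch q ((q^n)⁻¹) n * q^s) * this - (1 - q * q^n) * h1

/-- q-Chu-Vandermonde -/
lemma chu (q c x : F) (hq0 : q ≠ 0) (hq : ∀ i : ℕ, 1 - q * q^i ≠ 0)
    (hc : ∀ i : ℕ, 1 - c * q^i ≠ 0) (hx0 : x ≠ 0) (hx : ∀ i : ℕ, x - c * q^i ≠ 0) (m : ℕ) :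
    ∑ j ∈ Finset.range (m+1), qPoch q ((q^m)⁻¹) j * qPoch q x j * q^j / (qPoch q q j * qPoch q c j)
      = qPoch q (c/x) m * x^m / qPoch q c m := by
  induction m with
  | zero => simp [qPoch]
  | succ m ih =>
    set ν := (q^(m+1))⁻¹ with hν
    have hνq : ν * q^(m+1) = 1 := inv_mul_cancel₀ (pow_ne_zero _ hq0)
    have hν0 : ν ≠ 0 := inv_ne_zero (pow_ne_zero _ hq0)
    set u : ℕ → F := fun j => qPoch q ν j * qPoch q x j * q^j / (qPoch q q j * qPoch q c j) with hu
    have hrec : ∀ j, u (j+1) * ((1 - q * q^j) * (1 - c * q^j)) = u j * (q * (1 - ν * q^j) * (1 - x * q^j)) := by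
      intro j
      have h1 := hq j
      have h2 := hc j
      have h3 := qP_ne q q j hq
      have h4 := qP_ne q c j hc
      simp only [hu, qP_succ]
      rw [div_mul_eq_mul_div, div_mul_eq_mul_div, div_eq_div_iff (by positivity) (by positivity)]
      ring
    -- telescoping
    have htel : ∀ k, ∑ j ∈ Finset.range k, u j * ((q * (1 - ν - x) + c) + (q * ν * x - c) * q^j)
        = u k * ((1 - q^k) * (q - c * q^k)) / q^k := by
      intro k
      induction k with
      | zero => simp
      | succ k ihk =>
        rw [Finset.sum_range_succ, ihk]
        have e := hrec k
        have hk : q^k ≠ 0 := pow_ne_zero _ hq0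
        rw [div_add' _ _ _ hk, div_eq_div_iff hk (pow_ne_zero _ hq0)]
        rw [pow_succ]
        linear_combination (-(q^k) * q) * e
    have h0 := htel (m+1+1)
    have hz : u (m+1+1) = 0 := by
      simp only [hu]
      rw [hν, qP_inv_zero q hq0 (m+1) (m+1+1) (by omega)]; simp
    rw [hz, zero_mul, zero_div] at h0
    have hsplit : (q * (1 - ν - x) + c) * ∑ j ∈ Finset.range (m+1+1), u j
        + (q * ν * x - c) * ∑ j ∈ Finset.range (m+1+1), u j * q^j = 0 := by
      rw [← h0, Finset.mul_sum, Finset.mul_sum, ← Finset.sum_add_distrib]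
      exact Finset.sum_congr rfl fun j _ => by ring
    have hprev : (1 - ν) * (qPoch q (c/x) m * x^m / qPoch q c m)
       = ∑ j ∈ Finset.range (m+1+1), u j - ν * ∑ j ∈ Finset.range (m+1+1), u j * q^j := by
      rw [← ih, Finset.mul_sum, Finset.mul_sum, ← Finset.sum_sub_distrib, Finset.sum_range_succ _ (m+1)]
      have : u (m+1) - ν * (u (m+1) * q^(m+1)) = 0 := by linear_combination (-u (m+1)) * hνq
      rw [this, add_zero]
      refine Finset.sum_congr rfl fun j _ => ?_
      have e := qP_shift q ν j
      rw [hν, inv_shift q hq0, ← hν] at e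
      simp only [hu]
      linear_combination (qPoch q x j * q^j / (qPoch q q j * qPoch q c j)) * e
    set S := ∑ j ∈ Finset.range (m+1+1), u j
    set S1 := ∑ j ∈ Finset.range (m+1+1), u j * q^j
    have key : (q * ν * x - c) * ((1 - ν) * (qPoch q (c/x) m * x^m / qPoch q c m))
       = (1 - ν) * (q * ν - c) * S := by
      rw [hprev]
      linear_combination (-ν) * hsplit
    have hν1 : 1 - ν ≠ 0 := by
      intro h
      apply hq m
      have : ν = 1 := by linear_combination -h
      rw [this] at hνq
      rw [pow_succ] at hνq
      linear_combination -hνq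
    have k2 : (q * ν * x - c) * (qPoch q (c/x) m * x^m / qPoch q c m) = (q * ν - c) * S := by
      apply mul_left_cancel₀ hν1
      linear_combination key
    have hc4 := qP_ne q c m hc
    have hcm := hc m
    rw [qP_succ, qP_succ, eq_div_iff (mul_ne_zero hc4 hcm)]
    have e1 : (1 - c / x * q^m) * x^(m+1) = x^m * (x - c * q^m) := by field_simp; ring
    have e2 : q^m * (q * ν) = 1 := by rw [← hνq]; ring
    have k3 : (x - c * q^m) * (qPoch q (c/x) m * x^m / qPoch q c m) = (1 - c * q^m) * S := by
      linear_combination q^m * k2 - (x * (qPoch q (c/x) m * x^m / qPoch q c m) - S) * e2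
    have k4 : (x - c * q^m) * (qPoch q (c/x) m * x^m) = (1 - c * q^m) * S * qPoch q c m := by
      rw [← k3]; field_simp
    linear_combination -k4 - qPoch q (c/x) m * e1

/-- the factor `f_j` -/
noncomputable def ff (q : F) (m g j : ℕ) : F := qPoch q (q ^ ((j:ℤ) - m - g)) g

lemma ff_succ (q : F) (hq0 : q ≠ 0) (m g j : ℕ) :
    ff q m g (j+1) * (q^(m+g) - q^j) = ff q m g j * (q^(m+g) - q^(j+g)) := by
  have e := qP_shift q (q ^ ((j:ℤ) - m - g)) g
  have h1 : q ^ ((j:ℤ) - m - g) * q = q ^ (((j+1 : ℕ):ℤ) - m - g) := by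
    rw [← zpow_add_one₀ hq0]; congr 1; push_cast; ring
  have h2 : q^(m+g) * q ^ ((j:ℤ) - m - g) = q^j := by
    rw [← zpow_natCast, ← zpow_natCast, ← zpow_add₀ hq0]; congr 1; push_cast; ring
  rw [h1] at e
  unfold ff
  rw [pow_add q j g]
  linear_combination q^(m+g) * e - (-qPoch q (q ^ (((j+1 : ℕ):ℤ) - m - g)) g + qPoch q (q ^ ((j:ℤ) - m - g)) g * q^g) * h2

noncomputable def uu (q c x : F) (m g N j : ℕ) : F :=
  qPoch q ((q^N)⁻¹) j * qPoch q x j * ff q m g j * q^j / (qPoch q q j * qPoch q c j)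

lemma uu_rec (q c x : F) (hq0 : q ≠ 0) (hq : ∀ i : ℕ, 1 - q * q^i ≠ 0)
    (hc : ∀ i : ℕ, 1 - c * q^i ≠ 0) (m g N j : ℕ) :
    uu q c x m g N (j+1) * ((1 - q * q^j) * (1 - c * q^j) * (q^(m+g) - q^j))
     = uu q c x m g N j * (q * (1 - (q^N)⁻¹ * q^j) * (1 - x * q^j) * (q^(m+g) - q^(j+g))) := by
  have h1 := hq j
  have h2 := hc j
  have h3 := qP_ne q q j hq
  have h4 := qP_ne q c j hc
  have e := ff_succ q hq0 m g j
  simp only [uu, qP_succ]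
  set ν := (q^N)⁻¹
  rw [div_mul_eq_mul_div, div_mul_eq_mul_div, div_eq_div_iff (by positivity) (by positivity)]
  rw [pow_succ q j]
  linear_combination (qPoch q ν j * (1 - ν * q^j) * (qPoch q x j * (1 - x * q^j)) * (q^j * q) * (1 - q * q^j) * (1 - c * q^j) * qPoch q q j * qPoch q c j) * e

lemma uu_tel (q c x : F) (hq0 : q ≠ 0) (hq : ∀ i : ℕ, 1 - q * q^i ≠ 0)
    (hc : ∀ i : ℕ, 1 - c * q^i ≠ 0) (m g N : ℕ) (k : ℕ) (ν M G : F) (hν : ν = (q^N)⁻¹) (hM : M = q^m) (hG : G = q^g) :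
    ∑ j ∈ Finset.range k, uu q c x m g N j *
      ((-(ν + x) * q^2 * M * G - q^2 * G + (q + c) * q * M * G + q) +
       (ν * x * q^2 * M * G + (ν + x) * q^2 * G - (q + c) - c * q * M * G) * q^j +
       (c - ν * x * q^2 * G) * (q^j)^2)
      = uu q c x m g N k * ((1 - q^k) * (q - c * q^k) * (q * M * G - q^k)) / q^k := by
  induction k with
  | zero => simp
  | succ k ihk =>
    rw [Finset.sum_range_succ, ihk]
    have e := uu_rec q c x hq0 hq hc m g N k
    rw [← hν, pow_add, pow_add, ← hM, ← hG] at e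
    have hk : q^k ≠ 0 := pow_ne_zero _ hq0
    rw [div_add' _ _ _ hk, div_eq_div_iff hk (pow_ne_zero _ hq0)]
    rw [pow_succ]
    linear_combination (-(q^k) * q^2) * e

noncomputable def DD (q c x : F) (m g N K : ℕ) : F :=
  ∑ j ∈ Finset.range (m+1), ∑ k ∈ Finset.range K,
    uu q c x m g N j * uu q c x m g N k * (q^j - q^k)

lemma DD_eq (q c x : F) (m g N K : ℕ) : DD q c x m g N K =
    (∑ j ∈ Finset.range (m+1), uu q c x m g N j * q^j) * (∑ j ∈ Finset.range K, uu q c x m g N j)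
    - (∑ j ∈ Finset.range (m+1), uu q c x m g N j) * (∑ j ∈ Finset.range K, uu q c x m g N j * q^j) := by
  rw [DD, Finset.sum_mul_sum, Finset.sum_mul_sum, ← Finset.sum_sub_distrib]
  refine Finset.sum_congr rfl fun j _ => ?_
  rw [← Finset.sum_sub_distrib]
  exact Finset.sum_congr rfl fun k _ => by ring

lemma uu_zero (q c x : F) (hq0 : q ≠ 0) (m g N k : ℕ) (h : N < k) : uu q c x m g N k = 0 := by
  rw [uu, qP_inv_zero q hq0 N k h]; simp

lemma DD_step (q c x : F) (hq0 : q ≠ 0) (hq : ∀ i : ℕ, 1 - q * q^i ≠ 0)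
    (hc : ∀ i : ℕ, 1 - c * q^i ≠ 0) (m g d N : ℕ) (hN : N = m+g+1+d) :
    DD q c x m g (N+1) (N+1+1) * ((1 - c * q^N) * (1 - q * q^d) * q^m)
     = DD q c x m g N (N+1) * ((1 - q * q^N) * (x - c * q^(m+d))) := by
  have hext : DD q c x m g N (N+1) = DD q c x m g N (N+1+1) := by
    simp only [DD]
    refine Finset.sum_congr rfl fun j _ => ?_
    rw [Finset.sum_range_succ _ (N+1), uu_zero q c x hq0 m g N (N+1) (by omega)]
    simp
  rw [hext, DD_eq, DD_eq]
  obtain ⟨ν, hν⟩ : ∃ ν, ν = (q^(N+1))⁻¹ := ⟨_, rfl⟩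
  have hνq : ν * q^(N+1) = 1 := by rw [hν]; exact inv_mul_cancel₀ (pow_ne_zero _ hq0)
  have hsh : ∀ j, (1 - ν) * uu q c x m g N j = uu q c x m g (N+1) j * (1 - ν * q^j) := by
    intro j
    have e := qP_shift q ν j
    rw [hν, inv_shift q hq0, ← hν] at e
    simp only [uu, ← hν]
    linear_combination (qPoch q x j * ff q m g j * q^j / (qPoch q q j * qPoch q c j)) * e
  have hA : ∀ K, (1 - ν) * ∑ j ∈ Finset.range K, uu q c x m g N j
      = ∑ j ∈ Finset.range K, uu q c x m g (N+1) j - ν * ∑ j ∈ Finset.range K, uu q c x m g (N+1) j * q^j := by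
    intro K
    rw [Finset.mul_sum, Finset.mul_sum, ← Finset.sum_sub_distrib]
    refine Finset.sum_congr rfl fun j _ => ?_
    rw [hsh]; ring
  have hB : ∀ K, (1 - ν) * ∑ j ∈ Finset.range K, uu q c x m g N j * q^j
      = ∑ j ∈ Finset.range K, uu q c x m g (N+1) j * q^j - ν * ∑ j ∈ Finset.range K, uu q c x m g (N+1) j * (q^j)^2 := by
    intro K
    rw [Finset.mul_sum, Finset.mul_sum, ← Finset.sum_sub_distrib]
    refine Finset.sum_congr rfl fun j _ => ?_
    linear_combination q^j * hsh j
  obtain ⟨M, hM⟩ : ∃ M, M = q^m := ⟨_, rfl⟩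
  obtain ⟨G, hG⟩ : ∃ G, G = q^g := ⟨_, rfl⟩
  obtain ⟨a0, ha0⟩ : ∃ a, a = (-(ν + x) * q^2 * M * G - q^2 * G + (q + c) * q * M * G + q) := ⟨_, rfl⟩
  obtain ⟨a1, ha1⟩ : ∃ a, a = (ν * x * q^2 * M * G + (ν + x) * q^2 * G - (q + c) - c * q * M * G) := ⟨_, rfl⟩
  obtain ⟨a2, ha2⟩ : ∃ a, a = (c - ν * x * q^2 * G) := ⟨_, rfl⟩
  have htel : ∀ K, a0 * ∑ j ∈ Finset.range K, uu q c x m g (N+1) j +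
      a1 * ∑ j ∈ Finset.range K, uu q c x m g (N+1) j * q^j +
      a2 * ∑ j ∈ Finset.range K, uu q c x m g (N+1) j * (q^j)^2 =
      uu q c x m g (N+1) K * ((1 - q^K) * (q - c * q^K) * (q * M * G - q^K)) / q^K := by
    intro K
    rw [← uu_tel q c x hq0 hq hc m g (N+1) K ν M G hν hM hG, ← ha0, ← ha1, ← ha2,
      Finset.mul_sum, Finset.mul_sum, Finset.mul_sum, ← Finset.sum_add_distrib, ← Finset.sum_add_distrib]
    exact Finset.sum_congr rfl fun j _ => by ring
  have t1 := htel (m+1)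
  have hz1 : uu q c x m g (N+1) (m+1) * (q * M * G - q^(m+1)) = 0 := by
    have e := uu_rec q c x hq0 hq hc m g (N+1) m
    rw [sub_self, mul_zero, mul_zero] at e
    have h1 := hq m
    have h2 := hc m
    apply mul_left_cancel₀ (mul_ne_zero h1 h2)
    rw [pow_add] at e
    rw [hM, hG]
    linear_combination q * e
  have hz2 : uu q c x m g (N+1) (m+1) * ((1 - q^(m+1)) * (q - c * q^(m+1)) * (q * M * G - q^(m+1))) = 0 := by
    linear_combination ((1 - q^(m+1)) * (q - c * q^(m+1))) * hz1
  rw [hz2, zero_div] at t1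
  have t2 := htel (N+1+1)
  rw [uu_zero q c x hq0 m g (N+1) (N+1+1) (by omega), zero_mul, zero_div] at t2
  have hA1 := hA (m+1)
  have hA2 := hA (N+1+1)
  have hB1 := hB (m+1)
  have hB2 := hB (N+1+1)
  generalize (∑ j ∈ Finset.range (m+1), uu q c x m g (N+1) j) = A1 at *
  generalize (∑ j ∈ Finset.range (m+1), uu q c x m g (N+1) j * q^j) = B1 at *
  generalize (∑ j ∈ Finset.range (m+1), uu q c x m g (N+1) j * (q^j)^2) = C1 at *
  generalize (∑ j ∈ Finset.range (N+1+1), uu q c x m g (N+1) j) = A at *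
  generalize (∑ j ∈ Finset.range (N+1+1), uu q c x m g (N+1) j * q^j) = B at *
  generalize (∑ j ∈ Finset.range (N+1+1), uu q c x m g (N+1) j * (q^j)^2) = C at *
  generalize (∑ j ∈ Finset.range (m+1), uu q c x m g N j) = A1' at *
  generalize (∑ j ∈ Finset.range (m+1), uu q c x m g N j * q^j) = B1' at *
  generalize (∑ j ∈ Finset.range (N+1+1), uu q c x m g N j) = A' at *
  generalize (∑ j ∈ Finset.range (N+1+1), uu q c x m g N j * q^j) = B' at *
  have hν1 : 1 - ν ≠ 0 := by
    intro h
    apply hq N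
    have : ν = 1 := by linear_combination -h
    rw [this] at hνq
    rw [pow_succ] at hνq
    linear_combination -hνq
  have k1 : a2 * ((1-ν)^2 * (B1' * A' - A1' * B')) = (a2 + ν * a1 + ν^2 * a0) * (B1 * A - A1 * B) := by
    have : (1-ν)^2 * (B1' * A' - A1' * B') = (B1 - ν * C1) * (A - ν * B) - (A1 - ν * B1) * (B - ν * C) := by
      rw [← hA1, ← hA2, ← hB1, ← hB2]; ring
    rw [this]
    linear_combination (-ν * (A - ν * B)) * t1 + (ν * (A1 - ν * B1)) * t2
  have k2 : a2 + ν * a1 + ν^2 * a0 = (1-ν) * ((q * ν - c) * (ν * q * M * G - 1)) := by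
    rw [ha0, ha1, ha2]; ring
  rw [k2] at k1
  have k3 : a2 * (1-ν) * (B1' * A' - A1' * B') = (q * ν - c) * (ν * q * M * G - 1) * (B1 * A - A1 * B) := by
    apply mul_left_cancel₀ hν1
    linear_combination k1
  have f1 : q^(m+d) * a2 = -(x - c * q^(m+d)) := by
    rw [ha2, hG]
    have : ν * (q^(m+d) * q^2 * q^g) = 1 := by rw [← hνq, hN]; ring
    linear_combination (-x) * this
  have f2 : q^N * (q * ν - c) = 1 - c * q^N := by
    linear_combination hνq
  have f3 : q^(d+1) * (ν * q * M * G - 1) = 1 - q * q^d := by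
    have : ν * (q^(d+1) * q * M * G) = 1 := by rw [← hνq, hN, hM, hG]; ring
    linear_combination this
  have f4 : q^(N+1) * (1 - ν) = -(1 - q * q^N) := by
    linear_combination -hνq
  have f5 : (1 - q * q^N) * (x - c * q^(m+d)) = q^(N+1) * (1-ν) * (q^(m+d) * a2) := by rw [f1, f4]; ring
  rw [f5, ← f2, ← f3]
  linear_combination (-q^(N+1) * q^(m+d)) * k3

lemma ff_zero (q : F) (hq0 : q ≠ 0) (m g k : ℕ) (h1 : m < k) (h2 : k ≤ m + g) : ff q m g k = 0 := by
  rw [ff, qPoch]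
  apply Finset.prod_eq_zero (i := m + g - k) (Finset.mem_range.2 (by omega))
  rw [← zpow_natCast q, ← zpow_add₀ hq0, Nat.cast_sub h2]
  push_cast
  rw [show (k:ℤ) - m - g + (m + g - k) = 0 by ring]
  simp

lemma ff_base (q : F) (hq0 : q ≠ 0) (m g j : ℕ) :
    qPoch q ((q^(m+g+1))⁻¹) j * ff q m g j * (q^j - q^(m+g+1))
     = -q^(m+g+1) * qPoch q ((q^(m+g+1))⁻¹) (g+1) * qPoch q ((q^m)⁻¹) j := by
  have e1 := qP_add q ((q^(m+g+1))⁻¹) j (g+1)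
  have e2 := qP_add q ((q^(m+g+1))⁻¹) (g+1) j
  rw [add_comm j (g+1), e2, qP_succ' q (_ * q^j) g] at e1
  have h1 : (q^(m+g+1))⁻¹ * q^(g+1) = (q^m)⁻¹ := by
    field_simp; ring
  have h2 : (q^(m+g+1))⁻¹ * q^j * q = q ^ ((j:ℤ) - m - g) := by
    rw [← zpow_natCast, ← zpow_natCast, ← zpow_neg, ← zpow_add₀ hq0, ← zpow_add_one₀ hq0]
    congr 1; push_cast; ring
  rw [h1, h2] at e1
  have h3 : q^(m+g+1) * (q^(m+g+1))⁻¹ = 1 := mul_inv_cancel₀ (pow_ne_zero _ hq0)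
  rw [ff]
  generalize qPoch q (q ^ ((j:ℤ) - m - g)) g = f at *
  generalize (q^(m+g+1))⁻¹ = ν at *
  linear_combination (q^(m+g+1)) * e1 - (q^j * qPoch q ν j * f) * h3

lemma DD_base (q c x : F) (hq0 : q ≠ 0) (hq : ∀ i : ℕ, 1 - q * q^i ≠ 0)
    (hc : ∀ i : ℕ, 1 - c * q^i ≠ 0) (hx0 : x ≠ 0) (hx : ∀ i : ℕ, x - c * q^i ≠ 0) (m g : ℕ) :
    DD q c x m g (m+g+1) (m+g+1+1) = uu q c x m g (m+g+1) (m+g+1) *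
      (-q^(m+g+1) * qPoch q ((q^(m+g+1))⁻¹) (g+1) * (qPoch q (c/x) m * x^m / qPoch q c m)) := by
  rw [DD_eq, Finset.sum_range_succ _ (m+g+1), Finset.sum_range_succ _ (m+g+1)]
  have hz : ∀ k ∈ Finset.range (m+g+1), k ∉ Finset.range (m+1) → uu q c x m g (m+g+1) k = 0 := by
    intro k h1 h2
    simp only [Finset.mem_range] at h1 h2
    rw [uu, ff_zero q hq0 m g k (by omega) (by omega)]; simp
  have hsub : Finset.range (m+1) ⊆ Finset.range (m+g+1) := Finset.range_subset_range.2 (by omega)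
  rw [← Finset.sum_subset hsub hz, ← Finset.sum_subset hsub (fun k h1 h2 => by rw [hz k h1 h2, zero_mul])]
  rw [← chu q c x hq0 hq hc hx0 hx m, Finset.mul_sum]
  have : ∑ j ∈ Finset.range (m+1), -q^(m+g+1) * qPoch q ((q^(m+g+1))⁻¹) (g+1) *
      (qPoch q ((q^m)⁻¹) j * qPoch q x j * q^j / (qPoch q q j * qPoch q c j))
      = ∑ j ∈ Finset.range (m+1), uu q c x m g (m+g+1) j * q^j
       - q^(m+g+1) * ∑ j ∈ Finset.range (m+1), uu q c x m g (m+g+1) j := by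
    rw [Finset.mul_sum, ← Finset.sum_sub_distrib]
    refine Finset.sum_congr rfl fun j _ => ?_
    rw [uu]
    linear_combination (-(qPoch q x j * q^j / (qPoch q q j * qPoch q c j))) * ff_base q hq0 m g j
  rw [this]
  ring

lemma base_const (q : F) (hq0 : q ≠ 0) (hq : ∀ i : ℕ, 1 - q * q^i ≠ 0) (m g t : ℕ) (ht : m * (m+1) = 2 * t) :
    -(q^(m+g+1) * q^(m+g+1)) * qPoch q ((q^(m+g+1))⁻¹) (g+1) * qPoch q ((q^(m+g+1))⁻¹) (m+g+1) * qPoch q q m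
     = (-1)^(m+1) * qPoch q q (m+g+1)^2 * q^((m:ℤ)+t - m*(m+g+1) - m*(g+1) - (g+1)^2 + (g+1)) := by
  obtain ⟨s, hs⟩ := Nat.even_mul_succ_self (m+g+1)
  have r1 := qP_rev q hq0 (m+g+1) s (by omega)
  have r2 := qP_rev q hq0 m t ht
  have e2 := qP_add q ((q^(m+g+1))⁻¹) (g+1) m
  have h1 : (q^(m+g+1))⁻¹ * q^(g+1) = (q^m)⁻¹ := by
    field_simp; ring
  rw [h1, show g+1+m = m+g+1 by ring] at e2
  have hz : q^(m+g+1) * q^(m+g+1) * q^t = q^((m:ℤ)+t - m*(m+g+1) - m*(g+1) - (g+1)^2 + (g+1)) * q^s * q^s := by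
    simp only [← zpow_natCast]
    simp only [← zpow_add₀ hq0]
    congr 1
    push_cast
    have : ((m:ℤ)+g+1)*(m+g+1+1) = s + s := by exact_mod_cast hs
    have : (m:ℤ)*(m+1) = 2*t := by exact_mod_cast ht
    linarith
  generalize q^((m:ℤ)+t - m*(m+g+1) - m*(g+1) - (g+1)^2 + (g+1)) = Z at *
  have hs0 : q^s ≠ 0 := pow_ne_zero _ hq0
  have hsg : ((-1:F)^m)^2 = 1 := by rw [← pow_mul, mul_comm, pow_mul]; simp
  have hsg' : ((-1:F)^(m+g+1))^2 = 1 := by rw [← pow_mul, mul_comm, pow_mul]; simp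
  have r2' : qPoch q q m = (-1)^m * (qPoch q ((q^m)⁻¹) m * q^t) := by
    rw [r2]; linear_combination (-qPoch q q m) * hsg
  have r1' : (qPoch q ((q^(m+g+1))⁻¹) (m+g+1) * q^s)^2 = qPoch q q (m+g+1)^2 := by
    rw [r1, mul_pow, hsg', one_mul]
  rw [r2', ← r1', pow_succ (-1:F)]
  generalize qPoch q ((q^(m+g+1))⁻¹) (m+g+1) = P at *
  generalize qPoch q ((q^(m+g+1))⁻¹) (g+1) = P1 at *
  generalize qPoch q ((q^m)⁻¹) m = P2 at *
  rw [e2]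
  linear_combination (-(-1)^m * P1^2 * P2^2) * hz

lemma DD_main (q c x : F) (hq0 : q ≠ 0) (hq : ∀ i : ℕ, 1 - q * q^i ≠ 0)
    (hc : ∀ i : ℕ, 1 - c * q^i ≠ 0) (hx0 : x ≠ 0) (hx : ∀ i : ℕ, x - c * q^i ≠ 0) (m g t d : ℕ)
    (ht : m * (m+1) = 2 * t) :
    DD q c x m g (m+g+1+d) (m+g+1+d+1) = (-1)^(m+1) * qPoch q q (m+g+1+d) * qPoch q q g *
      qPoch q x (m+g+1) * qPoch q (c/x) (m+d) * x^(m+d) *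
      q^((m:ℤ)+t - m*(m+g+1+d) - m*(g+1) - (g+1)^2 + (g+1)) /
      (qPoch q q m * qPoch q c m * qPoch q c (m+g+1+d) * qPoch q q d) := by
  have n1 := fun k => qP_ne q q k hq
  have n2 := fun k => qP_ne q c k hc
  induction d with
  | zero =>
    simp only [add_zero, Nat.cast_zero]
    rw [DD_base q c x hq0 hq hc hx0 hx, uu]
    have hf : ff q m g (m+g+1) = qPoch q q g := by
      rw [ff]; congr 1; push_cast
      rw [show (m:ℤ) + g + 1 - m - g = 1 by ring, zpow_one]
    have b := base_const q hq0 hq m g t ht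
    rw [hf, qP_zero, mul_one]
    generalize q^((m:ℤ)+t - m*(m+g+1) - m*(g+1) - (g+1)^2 + (g+1)) = Z at *
    have := n1 m
    have := n2 m
    have := n1 (m+g+1)
    have := n2 (m+g+1)
    rw [← mul_div_assoc, div_mul_div_comm, div_eq_div_iff (by positivity) (by positivity)]
    linear_combination (qPoch q x (m+g+1) * qPoch q q g * (qPoch q (c/x) m * x^m) * qPoch q c m * qPoch q c (m+g+1)) * b
  | succ d ih =>
    have st := DD_step q c x hq0 hq hc m g d (m+g+1+d) rfl
    rw [ih] at st
    have hne : (1 - c * q^(m+g+1+d)) * (1 - q * q^d) * q^m ≠ 0 :=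
      mul_ne_zero (mul_ne_zero (hc _) (hq _)) (pow_ne_zero _ hq0)
    rw [← eq_div_iff hne] at st
    rw [show m+g+1+(d+1) = m+g+1+d+1 by ring, st, show m+(d+1) = m+d+1 by ring]
    generalize qPoch q x (m+g+1) = X at *
    simp only [qP_succ]
    have e1 : (1 - c / x * q^(m+d)) * x^(m+d+1) = x^(m+d) * (x - c * q^(m+d)) := by field_simp; ring
    have hz : q^((m:ℤ)+t - m*(m+g+1+d) - m*(g+1) - (g+1)^2 + (g+1))
       = q^((m:ℤ)+t - m*(m+g+1+((d+1:ℕ):ℤ)) - m*(g+1) - (g+1)^2 + (g+1)) * q^m := by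
      rw [← zpow_natCast q m, ← zpow_add₀ hq0]
      congr 1; push_cast; ring
    rw [hz]
    generalize q^((m:ℤ)+t - m*(m+g+1+((d+1:ℕ):ℤ)) - m*(g+1) - (g+1)^2 + (g+1)) = Z at *
    have := n1 m
    have := n2 m
    have := n1 d
    have := n2 (m+g+1+d)
    have := hc (m+g+1+d)
    have := hq d
    rw [div_mul_eq_mul_div, div_div, div_eq_div_iff (by positivity) (by positivity)]
    generalize 1 - c / x * q^(m+d) = w at *
    linear_combination (-((-1)^(m+1) * qPoch q q (m+g+1+d) * (1 - q * q^(m+g+1+d)) * qPoch q q g * X * qPoch q (c/x) (m+d) * Z * q^m * (qPoch q q m * qPoch q c m * (qPoch q c (m+g+1+d) * (1 - c * q^(m+g+1+d))) * (qPoch q q d * (1 - q * q^d))))) * e1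

end aux

lemma F3_ne (p : MvPolynomial (Fin 3) ℚ) (v : Fin 3 → ℚ) (h : MvPolynomial.eval v p ≠ 0) :
    algebraMap (MvPolynomial (Fin 3) ℚ) F3 p ≠ 0 := by
  intro h0
  apply h
  have : p = 0 := (IsFractionRing.injective (MvPolynomial (Fin 3) ℚ) F3) (by rw [h0, map_zero])
  rw [this, map_zero]

lemma hq0_F3 : q ≠ 0 := F3_ne _ (fun _ => 1) (by simp)
lemma hx0_F3 : x ≠ 0 := F3_ne _ (fun _ => 1) (by simp)
lemma hq_F3 (i : ℕ) : 1 - q * q^i ≠ 0 := by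
  have := F3_ne (1 - MvPolynomial.X 0 * MvPolynomial.X 0 ^ i) (fun _ => 0) (by simp)
  simpa [q] using this
lemma hc_F3 (i : ℕ) : 1 - c * q^i ≠ 0 := by
  have := F3_ne (1 - MvPolynomial.X 1 * MvPolynomial.X 0 ^ i) (fun _ => 0) (by simp)
  simpa [q, c] using this
lemma hx_F3 (i : ℕ) : x - c * q^i ≠ 0 := by
  have := F3_ne (MvPolynomial.X 2 - MvPolynomial.X 1 * MvPolynomial.X 0 ^ i) ![1, 0, 1] (by simp)
  simpa [q, c, x] using this

theorem double_sum_lemma (n h m : ℕ) (hn : 0 < n) (hh : 0 < h) (hnm : h ≤ n - m) :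
    ∑ j ∈ Finset.range (m + 1), ∑ k ∈ Finset.range (n + 1),
        qPoch q ((q ^ n)⁻¹) j * qPoch q ((q ^ n)⁻¹) k * qPoch q x j * qPoch q x k *
          qPoch q (q ^ ((j : ℤ) - m - h + 1)) (h - 1) *
          qPoch q (q ^ ((k : ℤ) - m - h + 1)) (h - 1) *
          (1 - q ^ ((k : ℤ) - j)) * q ^ (2 * j + k) /
          (qPoch q q j * qPoch q q k * qPoch q c j * qPoch q c k) =
    (-1 : F3) ^ ((m : ℤ) - 1) * qPoch q q n * qPoch q q (h - 1) * qPoch q x (m + h) *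
      qPoch q (c / x) (n - h) * x ^ (n - h) *
      q ^ ((((m : ℤ) ^ 2 + 3 * m) / 2) - m * n - m * h - (h : ℤ) ^ 2 + h) /
      (qPoch q q m * qPoch q c m * qPoch q c n * qPoch q q (n - m - h)) := by
  obtain ⟨g, rfl⟩ : ∃ g, h = g + 1 := ⟨h - 1, by omega⟩
  obtain ⟨d, rfl⟩ : ∃ d, n = m + g + 1 + d := ⟨n - m - g - 1, by omega⟩
  obtain ⟨t, ht⟩ := Nat.even_mul_succ_self m
  have main := DD_main q c x hq0_F3 hq_F3 hc_F3 hx0_F3 hx_F3 m g t d (by omega)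
  have e1 : m + g + 1 + d - (g + 1) = m + d := by omega
  have e2 : m + g + 1 + d - m - (g + 1) = d := by omega
  have e3 : (-1 : F3) ^ ((m : ℤ) - 1) = (-1) ^ (m + 1) := by
    rw [zpow_sub₀ (by simp), zpow_natCast, pow_succ, zpow_one, div_neg, div_one]; ring
  have e4 : ((m:ℤ)^2 + 3 * m) / 2 = m + t := by
    have : (m:ℤ) * (m+1) = t + t := by exact_mod_cast ht
    have : (m:ℤ)^2 + 3 * m = 2 * (m + t) := by linarith
    omega
  rw [e1, e2, e3, e4, Nat.add_sub_cancel, ← add_assoc m g 1]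
  push_cast
  rw [← main, DD]
  refine Finset.sum_congr rfl fun j _ => Finset.sum_congr rfl fun k _ => ?_
  have p1 : ∀ i : ℕ, (i:ℤ) - m - (g + 1) + 1 = i - m - g := fun i => by ring
  have p2 : (1 - q ^ ((k:ℤ) - j)) * q ^ (2 * j + k) = q^j * q^k * (q^j - q^k) := by
    have : q ^ ((k:ℤ) - j) * q^j = q^k := by
      rw [← zpow_natCast q j, ← zpow_add₀ hq0_F3, sub_add_cancel, zpow_natCast]
    rw [pow_add, two_mul, pow_add]
    linear_combination (-q^j * q^k) * this
  rw [p1, p1, uu, uu, ff, ff, mul_assoc _ (1 - q ^ ((k:ℤ) - j)), p2]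
  rw [div_mul_div_comm, div_mul_eq_mul_div]
  congr 1 <;> ring
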